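/- Let p be an odd prime, k a positive integer, and 0 ≤ j < k. For every subgroup R of GL₂(ℤ/p^{k+1}ℤ) with c_k(π(R)) = 2p^j, one has c_{k+1}(R) ∈ {0, p^j, 2p^j}; conversely each of the values 0, p^j, 2p^j equals c_{k+1}(R) for some subgroup R of GL₂(ℤ/p^{k+1}ℤ) with c_k(π(R)) = 2p^j. -/

import Mathlib

open Matrix

abbrev GL2 (N : ℕ) := GL (Fin 2) (ZMod N)

/-- The Borel subgroup `B₀(N)` of upper-triangular matrices, as a set. -/
def B0 (N : ℕ) : Set (GL2 N) :=
  {g | (g : Matrix (Fin 2) (Fin 2) (ZMod N)) 1 0 = 0}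

/-- The number of `g` with `g R g⁻¹ ⊆ H`. -/
noncomputable def conjCount {N : ℕ} (H : Set (GL2 N)) (R : Subgroup (GL2 N)) : ℕ :=
  Nat.card {g : GL2 N | ∀ r ∈ R, g * r * g⁻¹ ∈ H}

/-- `S(H)`: the set of `m` with `#{g : gRg⁻¹ ⊆ H} = m * #H` for some subgroup `R`. -/
def Sset {N : ℕ} (H : Set (GL2 N)) : Set ℕ :=
  {m | ∃ R : Subgroup (GL2 N), conjCount H R = m * Nat.card H}
/-- Reduction `GL₂(ℤ/p^{k+1}ℤ) →* GL₂(ℤ/p^kℤ)` induced by reduction of entries mod `p^k`. -/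
def redGL (p k : ℕ) : GL2 (p ^ (k + 1)) →* GL2 (p ^ k) :=
  Units.map ((ZMod.castHom (pow_dvd_pow p (Nat.le_succ k)) (ZMod (p ^ k))).mapMatrix.toMonoidHom)

/-- Solutions in `[0, p^n)` of the system `c i + d i * z - b i * z ^ 2 ≡ 0 (mod p^n)`. -/
noncomputable def affineRoots {ι : Type*} (p n : ℕ) (b c d : ι → ℤ) : Finset ℤ :=
  open Classical in
  {z ∈ Finset.Ico (0 : ℤ) (p ^ n) | ∀ i, (p ^ n : ℤ) ∣ c i + d i * z - b i * z ^ 2}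

/-- Solutions in `[0, p^n)`, divisible by `p`, of `c i * w ^ 2 + d i * w - b i ≡ 0 (mod p^n)`. -/
noncomputable def infinityRoots {ι : Type*} (p n : ℕ) (b c d : ι → ℤ) : Finset ℤ :=
  open Classical in
  {w ∈ Finset.Ico (0 : ℤ) (p ^ n) | (p : ℤ) ∣ w ∧
    ∀ i, (p ^ n : ℤ) ∣ c i * w ^ 2 + d i * w - b i}

theorem mem_affineRoots {ι : Type*} {p n : ℕ} {b c d : ι → ℤ} {z : ℤ} :
    z ∈ affineRoots p n b c d ↔
      (0 ≤ z ∧ z < p ^ n) ∧ ∀ i, (p ^ n : ℤ) ∣ c i + d i * z - b i * z ^ 2 := by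
  simp [affineRoots]

theorem mem_infinityRoots {ι : Type*} {p n : ℕ} {b c d : ι → ℤ} {w : ℤ} :
    w ∈ infinityRoots p n b c d ↔
      (0 ≤ w ∧ w < p ^ n) ∧ (p : ℤ) ∣ w ∧
        ∀ i, (p ^ n : ℤ) ∣ c i * w ^ 2 + d i * w - b i := by
  simp [infinityRoots]

theorem card_Ico_filter_pow_dvd_sub {p n e : ℕ} (hp : 0 < p) (he : e ≤ n) (x : ℤ) :
    (Finset.filter (fun z => (p ^ e : ℤ) ∣ z - x) (Finset.Ico (0 : ℤ) (p ^ n))).card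
      = p ^ (n - e) := by
  have hpe : (0 : ℤ) < (p : ℤ) ^ e := by positivity
  have h := Int.Ico_filter_modEq_card 0 ((p : ℤ) ^ n) hpe x
  have hfil : Finset.filter (fun z => (p ^ e : ℤ) ∣ z - x) (Finset.Ico (0 : ℤ) (p ^ n))
      = Finset.filter (fun z => z ≡ x [ZMOD (p : ℤ) ^ e]) (Finset.Ico (0 : ℤ) (p ^ n)) := by
    ext z
    simp only [Finset.mem_filter, Int.modEq_iff_dvd, dvd_sub_comm]
  rw [hfil]
  have hpq : (p : ℚ) ≠ 0 := by positivity
  have hq : (((p : ℤ) ^ n - x : ℚ) / ((p : ℤ) ^ e : ℤ) : ℚ)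
      = ((0 : ℤ) - x : ℚ) / ((p : ℤ) ^ e : ℤ) + ((p ^ (n - e) : ℕ) : ℤ) := by
    push_cast
    have : (p : ℚ) ^ n = p ^ (n - e) * p ^ e := by rw [← pow_add, Nat.sub_add_cancel he]
    rw [this]
    field_simp
    ring
  push_cast at h hq
  rw [hq] at h
  have h2 : ((p : ℚ) ^ (n - e)) = (((p ^ (n - e) : ℕ) : ℤ) : ℚ) := by push_cast; rfl
  rw [h2, Int.ceil_add_intCast, add_sub_cancel_left, max_eq_left (by positivity)] at h
  exact_mod_cast h

theorem pow_dvd_of_pow_add_dvd_mul {p : ℕ} (hp : p.Prime) {s t : ℕ} {b w : ℤ}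
    (hb : ¬ (p ^ (s + 1) : ℤ) ∣ b) (h : (p ^ (s + t) : ℤ) ∣ b * w) : (p ^ t : ℤ) ∣ w := by
  have hp' : Prime (p : ℤ) := Nat.prime_iff_prime_int.1 hp
  induction s generalizing b with
  | zero =>
    rw [zero_add, pow_one] at hb
    rw [zero_add] at h
    exact hp'.pow_dvd_of_dvd_mul_left t hb h
  | succ s ih =>
    by_cases hpb : (p : ℤ) ∣ b
    · obtain ⟨b', rfl⟩ := hpb
      refine ih (b := b') (fun h' => hb ?_) ?_
      · rw [pow_succ']; exact mul_dvd_mul_left _ h'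
      · rw [show s + 1 + t = (s + t) + 1 by ring, pow_succ', mul_assoc] at h
        exact (mul_dvd_mul_iff_left hp'.ne_zero).1 h
    · exact (pow_dvd_pow _ (by omega)).trans (hp'.pow_dvd_of_dvd_mul_left _ hpb h)

theorem exists_maximal_pow_dvd {α : Type*} (p : ℕ) (f : α → ℤ) {e : ℕ}
    (h : ∃ i, ¬ (p ^ e : ℤ) ∣ f i) :
    ∃ s < e, (∀ i, (p ^ s : ℤ) ∣ f i) ∧ ∃ i, ¬ (p ^ (s + 1) : ℤ) ∣ f i := by
  induction e with
  | zero => simp at h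
  | succ e ih =>
    by_cases h' : ∃ i, ¬ (p ^ e : ℤ) ∣ f i
    · obtain ⟨s, hs, h2⟩ := ih h'
      exact ⟨s, by omega, h2⟩
    · push Not at h'
      exact ⟨e, by omega, h', h⟩

/-- Two roots `x`, `y` of the system modulo `p ^ k` at distance exactly `p ^ a` : the roots
modulo `p ^ (k + 1)` close to `x` form a ball or do not exist. -/
theorem card_roots_near {ι : Type*} {p k a β : ℕ} (hp : p.Prime) {b c d : ι → ℤ} {x y : ℤ}
    (hy : ∀ i, (p ^ k : ℤ) ∣ c i + d i * y - b i * y ^ 2)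
    (hxy : (p ^ a : ℤ) ∣ y - x) (hxy' : ¬ (p ^ (a + 1) : ℤ) ∣ y - x)
    (hb : ∀ i, (p ^ β : ℤ) ∣ b i) (hb' : ∃ i, ¬ (p ^ (β + 1) : ℤ) ∣ b i)
    (hk : 2 * a + β < k) :
    (Finset.filter (fun z => (p ^ (k - β - a) : ℤ) ∣ z - x)
      (affineRoots p (k + 1) b c d)).card = 0 ∨
    (Finset.filter (fun z => (p ^ (k - β - a) : ℤ) ∣ z - x)
      (affineRoots p (k + 1) b c d)).card = p ^ (a + β) := by
  rcases Finset.eq_empty_or_nonempty (Finset.filter (fun z => (p ^ (k - β - a) : ℤ) ∣ z - x)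
      (affineRoots p (k + 1) b c d)) with h0 | ⟨x', hx'⟩
  · left; rw [h0]; rfl
  right
  rw [Finset.mem_filter, mem_affineRoots] at hx'
  obtain ⟨⟨-, hx'r⟩, hx'x⟩ := hx'
  have far : ∀ z : ℤ, (p ^ (k - β - a) : ℤ) ∣ z - x →
      (p ^ a : ℤ) ∣ z - y ∧ ¬ (p ^ (a + 1) : ℤ) ∣ z - y := by
    intro z hz
    have h1 : (p ^ (a + 1) : ℤ) ∣ z - x := (pow_dvd_pow _ (by omega)).trans hz
    have h2 : (p ^ a : ℤ) ∣ z - x := (pow_dvd_pow _ (by omega)).trans hz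
    refine ⟨by simpa using dvd_sub h2 hxy, fun h => hxy' ?_⟩
    simpa using dvd_sub h1 h
  have key : ∀ z : ℤ, (p ^ (k - β - a) : ℤ) ∣ z - x →
      ((∀ i, (p ^ (k + 1) : ℤ) ∣ c i + d i * z - b i * z ^ 2) ↔
        (p ^ (k + 1 - β - a) : ℤ) ∣ z - x') := by
    intro z hz
    have hzx' : (p ^ (k - β - a) : ℤ) ∣ z - x' := by simpa using dvd_sub hz hx'x
    have hD : ∀ i, (p ^ (k - a) : ℤ) ∣ d i - b i * (y + x') := by
      intro i
      refine pow_dvd_of_pow_add_dvd_mul hp (s := a) (far x' hx'x).2 ?_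
      rw [show a + (k - a) = k by omega]
      have h1 := (pow_dvd_pow (p : ℤ) (Nat.le_succ k)).trans (hx'r i)
      have h2 : (p ^ k : ℤ) ∣ _ := dvd_sub h1 (hy i)
      convert h2 using 1
      ring
    have hred : ∀ i, (p ^ (k + 1) : ℤ) ∣ c i + d i * z - b i * z ^ 2 ↔
        (p ^ (k + 1) : ℤ) ∣ b i * (z - x') * (z - y) := by
      intro i
      have h1 : (p ^ (k + 1) : ℤ) ∣ (z - x') * (d i - b i * (y + x')) := by
        refine (pow_dvd_pow _ ?_).trans (pow_add (p : ℤ) _ _ ▸ mul_dvd_mul hzx' (hD i))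
        omega
      have h2 := dvd_add (hx'r i) h1
      rw [← dvd_sub_right (c := b i * (z - x') * (z - y)) h2, iff_eq_eq]
      congr 1
      ring
    simp only [hred]
    constructor
    · intro h
      obtain ⟨i, hi⟩ := hb'
      refine pow_dvd_of_pow_add_dvd_mul hp (s := β) hi
        (pow_dvd_of_pow_add_dvd_mul hp (s := a) (far z hz).2 ?_)
      rw [show a + (β + (k + 1 - β - a)) = k + 1 by omega, mul_comm]
      exact h i
    · intro h i
      have := mul_dvd_mul (mul_dvd_mul (hb i) h) (far z hz).1
      rwa [← pow_add, ← pow_add, show β + (k + 1 - β - a) + a = k + 1 by omega] at this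
  have hset : Finset.filter (fun z => (p ^ (k - β - a) : ℤ) ∣ z - x)
      (affineRoots p (k + 1) b c d) = Finset.filter (fun z => (p ^ (k + 1 - β - a) : ℤ) ∣ z - x')
      (Finset.Ico (0 : ℤ) (p ^ (k + 1))) := by
    ext z
    simp only [Finset.mem_filter, mem_affineRoots, Finset.mem_Ico, and_assoc]
    refine and_congr_right fun _ => and_congr_right fun _ => ?_
    constructor
    · rintro ⟨h1, h2⟩; exact (key z h2).1 h1
    · intro h
      have h2 : (p ^ (k - β - a) : ℤ) ∣ z - x := by
        have h3 : (p ^ (k - β - a) : ℤ) ∣ z - x' := (pow_dvd_pow _ (by omega)).trans h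
        simpa using dvd_add h3 hx'x
      exact ⟨(key z h2).2 h, h2⟩
  rw [hset, card_Ico_filter_pow_dvd_sub hp.pos (by omega)]
  congr 1
  omega

theorem card_affineRoots_succ {ι : Type*} {p k j : ℕ} (hp : p.Prime) (hodd : Odd p)
    {b c d : ι → ℤ} (h : (affineRoots p k b c d).card = 2 * p ^ j) :
    (affineRoots p (k + 1) b c d).card = 0 ∨ (affineRoots p (k + 1) b c d).card = p ^ j ∨
      (affineRoots p (k + 1) b c d).card = 2 * p ^ j := by
  classical
  have hpos : 0 < p ^ j := pow_pos hp.pos _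
  obtain ⟨x, hx, y₀, hy₀, hne⟩ := Finset.one_lt_card.1 (by omega : 1 < (affineRoots p k b c d).card)
  obtain ⟨a, hak, hall, ⟨y, hyZ⟩, hy'⟩ := exists_maximal_pow_dvd p
    (fun z : affineRoots p k b c d => (z : ℤ) - x) (e := k) ⟨⟨y₀, hy₀⟩, fun hd => hne (by
      have h1 := (mem_affineRoots.1 hx).1
      have h2 := (mem_affineRoots.1 hy₀).1
      have := Int.eq_zero_of_abs_lt_dvd hd (abs_lt.2 ⟨by simp only; linarith, by simp only; linarith⟩)
      simp only at this
      linarith)⟩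
  simp only at hy'
  have hxy : (p ^ a : ℤ) ∣ y - x := hall ⟨y, hyZ⟩
  replace hall : ∀ z ∈ affineRoots p k b c d, (p ^ a : ℤ) ∣ z - x := fun z hz => hall ⟨z, hz⟩
  have hxr := (mem_affineRoots.1 hx).2
  have hyr := (mem_affineRoots.1 hyZ).2
  have key : ∀ z : ℤ, (p ^ a : ℤ) ∣ z - x → ∀ i,
      ((p ^ k : ℤ) ∣ c i + d i * z - b i * z ^ 2 ↔ (p ^ k : ℤ) ∣ b i * ((z - x) * (z - y))) := by
    intro z hz i
    have hD : (p ^ (k - a) : ℤ) ∣ d i - b i * (y + x) := by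
      refine pow_dvd_of_pow_add_dvd_mul hp (s := a) hy' ?_
      rw [show a + (k - a) = k by omega]
      have h2 : (p ^ k : ℤ) ∣ _ := dvd_sub (hyr i) (hxr i)
      convert h2 using 1
      ring
    have h1 : (p ^ k : ℤ) ∣ (z - x) * (d i - b i * (y + x)) := by
      refine (pow_dvd_pow _ ?_).trans (pow_add (p : ℤ) _ _ ▸ mul_dvd_mul hz hD)
      omega
    have h2 := dvd_add (hxr i) h1
    rw [← dvd_sub_right (c := b i * ((z - x) * (z - y))) h2, iff_eq_eq]
    congr 1
    ring
  by_cases hball : ∀ i, (p ^ k : ℤ) ∣ b i * p ^ (2 * a)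
  · exfalso
    have hset : affineRoots p k b c d = Finset.filter (fun z => (p ^ a : ℤ) ∣ z - x)
        (Finset.Ico (0 : ℤ) (p ^ k)) := by
      ext z
      refine ⟨fun hz => ?_, fun hz => ?_⟩
      · rw [Finset.mem_filter, Finset.mem_Ico]
        exact ⟨(mem_affineRoots.1 hz).1, hall z hz⟩
      · rw [Finset.mem_filter, Finset.mem_Ico] at hz
        refine mem_affineRoots.2 ⟨hz.1, fun i => (key z hz.2 i).2 ((hball i).trans ?_)⟩
        rw [two_mul, pow_add]
        refine mul_dvd_mul_left _ (mul_dvd_mul hz.2 ?_)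
        simpa using dvd_sub hz.2 hxy
    rw [hset, card_Ico_filter_pow_dvd_sub hp.pos hak.le] at h
    have h3 : Odd (p ^ (k - a)) := hodd.pow
    rw [h] at h3
    exact (Nat.not_odd_iff_even.2 (even_two_mul _)) h3
  · push Not at hball
    obtain ⟨i₀, hi₀⟩ := hball
    obtain ⟨β, -, hb, hb'⟩ := exists_maximal_pow_dvd p b (e := k)
      ⟨i₀, fun h' => hi₀ (h'.mul_right _)⟩
    have hk : 2 * a + β < k := by
      by_contra hc
      refine hi₀ ((pow_dvd_pow (p : ℤ) (by omega : k ≤ β + 2 * a)).trans ?_)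
      rw [pow_add]
      exact mul_dvd_mul_right (hb i₀) _
    have hprod : ∀ z : ℤ, (p ^ a : ℤ) ∣ z - x →
        ((∀ i, (p ^ k : ℤ) ∣ c i + d i * z - b i * z ^ 2) ↔
          ((p ^ (k - β - a) : ℤ) ∣ z - x ∨ (p ^ (k - β - a) : ℤ) ∣ z - y)) := by
      intro z hz
      have hzy : (p ^ a : ℤ) ∣ z - y := by simpa using dvd_sub hz hxy
      simp only [key z hz]
      constructor
      · intro hh
        obtain ⟨i, hi⟩ := hb'
        have h1 : (p ^ (k - β) : ℤ) ∣ (z - x) * (z - y) := by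
          refine pow_dvd_of_pow_add_dvd_mul hp (s := β) hi ?_
          rw [show β + (k - β) = k by omega]
          exact hh i
        rw [show k - β = a + (k - β - a) by omega] at h1
        by_cases h2 : (p ^ (a + 1) : ℤ) ∣ z - y
        · right
          refine pow_dvd_of_pow_add_dvd_mul hp (fun h3 => hy' ?_) h1
          simpa using dvd_sub h3 h2
        · left
          exact pow_dvd_of_pow_add_dvd_mul hp h2 (mul_comm (z - x) _ ▸ h1)
      · intro hh i
        have h1 : (p ^ (k - β) : ℤ) ∣ (z - x) * (z - y) := by
          rcases hh with hh | hh
          · have := mul_dvd_mul hh hzy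
            rwa [← pow_add, show k - β - a + a = k - β by omega] at this
          · have := mul_dvd_mul hz hh
            rwa [← pow_add, show a + (k - β - a) = k - β by omega] at this
        have := mul_dvd_mul (hb i) h1
        rwa [← pow_add, show β + (k - β) = k by omega] at this
    have hdisj : ∀ s : Finset ℤ, Disjoint
        (Finset.filter (fun z => (p ^ (k - β - a) : ℤ) ∣ z - x) s)
        (Finset.filter (fun z => (p ^ (k - β - a) : ℤ) ∣ z - y) s) := by
      intro s
      rw [Finset.disjoint_filter]
      intro z _ h1 h2
      refine hy' ((pow_dvd_pow (p : ℤ) (by omega : a + 1 ≤ k - β - a)).trans ?_)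
      simpa using dvd_sub h1 h2
    have hZ : affineRoots p k b c d =
        Finset.filter (fun z => (p ^ (k - β - a) : ℤ) ∣ z - x) (Finset.Ico (0 : ℤ) (p ^ k)) ∪
        Finset.filter (fun z => (p ^ (k - β - a) : ℤ) ∣ z - y) (Finset.Ico (0 : ℤ) (p ^ k)) := by
      rw [← Finset.filter_or]
      ext z
      rw [Finset.mem_filter, Finset.mem_Ico]
      refine ⟨fun hz => ?_, fun hz => ?_⟩
      · have h1 := mem_affineRoots.1 hz
        exact ⟨h1.1, (hprod z (hall z hz)).1 h1.2⟩
      · refine mem_affineRoots.2 ⟨hz.1, (hprod z ?_).2 hz.2⟩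
        have hle := pow_dvd_pow (p : ℤ) (by omega : a ≤ k - β - a)
        rcases hz.2 with h1 | h1
        · exact hle.trans h1
        · simpa using dvd_add (hle.trans h1) hxy
    have hcard : p ^ (a + β) = p ^ j := by
      rw [hZ, Finset.card_union_of_disjoint (hdisj _),
        card_Ico_filter_pow_dvd_sub hp.pos (by omega),
        card_Ico_filter_pow_dvd_sub hp.pos (by omega),
        show k - (k - β - a) = a + β by omega] at h
      omega
    have hZ' : affineRoots p (k + 1) b c d =
        Finset.filter (fun z => (p ^ (k - β - a) : ℤ) ∣ z - x) (affineRoots p (k + 1) b c d) ∪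
        Finset.filter (fun z => (p ^ (k - β - a) : ℤ) ∣ z - y) (affineRoots p (k + 1) b c d) := by
      rw [← Finset.filter_or, eq_comm, Finset.filter_eq_self]
      intro z hz
      have hpk : (0 : ℤ) < (p : ℤ) ^ k := pow_pos (by exact_mod_cast hp.pos) _
      have hroot : ∀ i, (p ^ k : ℤ) ∣ c i + d i * z - b i * z ^ 2 := fun i =>
        (pow_dvd_pow (p : ℤ) k.le_succ).trans ((mem_affineRoots.1 hz).2 i)
      refine (hprod z ?_).1 hroot
      have hmod : (p ^ k : ℤ) ∣ z - z % p ^ k := Int.dvd_self_sub_emod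
      have hz' : z % p ^ k ∈ affineRoots p k b c d := by
        refine mem_affineRoots.2 ⟨⟨Int.emod_nonneg _ hpk.ne', Int.emod_lt_of_pos _ hpk⟩,
          fun i => ?_⟩
        have h1 : (p ^ k : ℤ) ∣ _ := dvd_sub (hroot i) (hmod.mul_right (d i - b i * (z + z % p ^ k)))
        generalize z % p ^ k = r at h1 ⊢
        convert h1 using 1
        ring
      have h2 := dvd_add ((pow_dvd_pow (p : ℤ) hak.le).trans hmod) (hall _ hz')
      simpa using h2
    have hyx : (p ^ a : ℤ) ∣ x - y := (dvd_sub_comm).1 hxy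
    have hyx' : ¬ (p ^ (a + 1) : ℤ) ∣ x - y := fun h' => hy' ((dvd_sub_comm).1 h')
    rw [hZ', Finset.card_union_of_disjoint (hdisj _), ← hcard]
    have h1 := card_roots_near hp hyr hxy hy' hb hb' hk
    have h2 := card_roots_near hp hxr hyx hyx' hb hb' hk
    omega

theorem pow_dvd_binaryForm {p n : ℕ} (b c d x y : ℤ) :
    ((c : ZMod (p ^ n)) * (y : ZMod (p ^ n)) ^ 2 + d * (x * y) - b * x ^ 2 = 0) ↔
      (p ^ n : ℤ) ∣ c * y ^ 2 + d * (x * y) - b * x ^ 2 := by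
  have := ZMod.intCast_zmod_eq_zero_iff_dvd (c * y ^ 2 + d * (x * y) - b * x ^ 2) (p ^ n)
  push_cast at this
  exact this

theorem not_isUnit_intCast_iff {p n : ℕ} (hp : p.Prime) (hn : 0 < n) (w : ℤ) :
    ¬ IsUnit (w : ZMod (p ^ n)) ↔ (p : ℤ) ∣ w := by
  rw [ZMod.coe_int_isUnit_iff_isCoprime, Nat.cast_pow, IsCoprime.pow_left_iff hn,
    (Nat.prime_iff_prime_int.1 hp).coprime_iff_not_dvd, not_not]

theorem natCard_zmod_subtype {N : ℕ} (hN : 0 < N) (P : ZMod N → Prop) (s : Finset ℤ)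
    (hs : ∀ z : ℤ, z ∈ s ↔ (0 ≤ z ∧ z < N) ∧ P z) : Nat.card {z // P z} = s.card := by
  have : NeZero N := ⟨hN.ne'⟩
  rw [← Nat.card_eq_finsetCard s]
  have hval : ∀ z : ZMod N, (((z.val : ℕ) : ℤ) : ZMod N) = z := fun z => by simp
  refine Nat.card_congr (Equiv.ofBijective (fun z => ⟨((z.1.val : ℕ) : ℤ),
    (hs _).2 ⟨⟨by positivity, by exact_mod_cast z.1.val_lt⟩, by rw [hval]; exact z.2⟩⟩) ⟨?_, ?_⟩)
  · intro z z' h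
    have h1 : ((z.1.val : ℕ) : ℤ) = ((z'.1.val : ℕ) : ℤ) := congrArg Subtype.val h
    exact Subtype.ext (by rw [← hval z.1, h1, hval])
  · rintro ⟨z, hz⟩
    obtain ⟨⟨h0, h1⟩, h2⟩ := (hs z).1 hz
    refine ⟨⟨(z : ZMod N), h2⟩, Subtype.ext ?_⟩
    simp only [ZMod.natCast_val]
    rw [ZMod.coe_intCast, Int.emod_eq_of_lt h0 h1]

/-- The matrix with rows `(1, 0)` and `(z, 1)`. -/
def lowerUnipotent {N : ℕ} (z : ZMod N) : GL2 N :=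
  ⟨!![1, 0; z, 1], !![1, 0; -z, 1], by simp [Matrix.one_fin_two], by simp [Matrix.one_fin_two]⟩

/-- The matrix with rows `(0, 1)` and `(1, w)`. -/
def swapShear {N : ℕ} (w : ZMod N) : GL2 N :=
  ⟨!![0, 1; 1, w], !![-w, 1; 1, 0], by simp [Matrix.one_fin_two], by simp [Matrix.one_fin_two]⟩

theorem isUnit_of_mem_B0 {N : ℕ} {g : GL2 N} (hg : g ∈ B0 N) :
    IsUnit (g.1 0 0) ∧ IsUnit (g.1 1 1) := by
  have h := (Matrix.isUnit_iff_isUnit_det g.1).1 g.isUnit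
  have h0 : g.1 1 0 = 0 := hg
  rw [Matrix.det_fin_two, h0, mul_zero, sub_zero] at h
  exact IsUnit.mul_iff.1 h

theorem isUnit_bottomRow {p n : ℕ} (hp : p.Prime) (hn : 0 < n) (g : GL2 (p ^ n)) :
    IsUnit (g.1 1 0) ∨ IsUnit (g.1 1 1) := by
  by_contra! hc
  have h := (Matrix.isUnit_iff_isUnit_det g.1).1 g.isUnit
  rw [Matrix.det_fin_two] at h
  revert h hc
  obtain ⟨a, ha⟩ := ZMod.intCast_surjective (g.1 0 0)
  obtain ⟨b, hb⟩ := ZMod.intCast_surjective (g.1 0 1)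
  obtain ⟨c, hc⟩ := ZMod.intCast_surjective (g.1 1 0)
  obtain ⟨d, hd⟩ := ZMod.intCast_surjective (g.1 1 1)
  rw [← ha, ← hb, ← hc, ← hd, not_isUnit_intCast_iff hp hn, not_isUnit_intCast_iff hp hn]
  rintro ⟨h1, h2⟩
  have : ¬ IsUnit (((a * d - b * c : ℤ)) : ZMod (p ^ n)) :=
    (not_isUnit_intCast_iff hp hn _).2 (dvd_sub (h2.mul_left _) (h1.mul_left _))
  push_cast at this
  exact this

theorem natCard_of_bottomRow {p n : ℕ} (hp : p.Prime) (hn : 0 < n)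
    (Φ : ZMod (p ^ n) → ZMod (p ^ n) → Prop)
    (hΦ : ∀ u x y, IsUnit u → (Φ (u * x) (u * y) ↔ Φ x y)) :
    Nat.card {g : GL2 (p ^ n) // Φ (g.1 1 0) (g.1 1 1)} =
      (Nat.card {z // Φ z 1} + Nat.card {w // ¬ IsUnit w ∧ Φ 1 w}) *
        Nat.card (B0 (p ^ n)) := by
  have : NeZero (p ^ n) := ⟨(pow_pos hp.pos n).ne'⟩
  rw [← Nat.card_sum, ← Nat.card_prod]
  symm
  have hL : ∀ (β : GL2 (p ^ n)) z, β ∈ B0 (p ^ n) →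
      (β * lowerUnipotent z).1 1 0 = β.1 1 1 * z ∧ (β * lowerUnipotent z).1 1 1 = β.1 1 1 * 1 := by
    intro β z hβ
    have h0 : β.1 1 0 = 0 := hβ
    simp [h0, lowerUnipotent, Matrix.mul_apply, Fin.sum_univ_two]
  have hM : ∀ (β : GL2 (p ^ n)) w, β ∈ B0 (p ^ n) →
      (β * swapShear w).1 1 0 = β.1 1 1 * 1 ∧ (β * swapShear w).1 1 1 = β.1 1 1 * w := by
    intro β w hβ
    have h0 : β.1 1 0 = 0 := hβ
    simp [swapShear, Matrix.mul_apply, Fin.sum_univ_two, h0]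
  let f : ({z // Φ z 1} ⊕ {w // ¬ IsUnit w ∧ Φ 1 w}) × B0 (p ^ n) →
      {g : GL2 (p ^ n) // Φ (g.1 1 0) (g.1 1 1)} := fun q =>
    match q with
    | (Sum.inl z, β) => ⟨β.1 * lowerUnipotent z.1, by
        rw [(hL β.1 z.1 β.2).1, (hL β.1 z.1 β.2).2, hΦ _ _ _ (isUnit_of_mem_B0 β.2).2]
        exact z.2⟩
    | (Sum.inr w, β) => ⟨β.1 * swapShear w.1, by
        rw [(hM β.1 w.1 β.2).1, (hM β.1 w.1 β.2).2, hΦ _ _ _ (isUnit_of_mem_B0 β.2).2]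
        exact w.2.2⟩
  refine Nat.card_congr (Equiv.ofBijective f ⟨?_, ?_⟩)
  · rintro ⟨z | w, β⟩ ⟨z' | w', β'⟩ h
    · have h1 : β.1 * lowerUnipotent z.1 = β'.1 * lowerUnipotent z'.1 := congrArg Subtype.val h
      have h2 := hL β.1 z.1 β.2
      have h3 := hL β'.1 z'.1 β'.2
      rw [← h1, h2.1, h2.2] at h3
      have h4 : β.1.1 1 1 = β'.1.1 1 1 := by simpa using h3.2
      rw [← h4] at h3
      obtain rfl : z = z' := Subtype.ext ((isUnit_of_mem_B0 β.2).2.mul_left_cancel h3.1)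
      obtain rfl : β = β' := Subtype.ext (mul_right_cancel h1)
      rfl
    · exfalso
      have h1 : β.1 * lowerUnipotent z.1 = β'.1 * swapShear w'.1 := congrArg Subtype.val h
      have h2 := hL β.1 z.1 β.2
      have h3 := hM β'.1 w'.1 β'.2
      rw [← h1, h2.1, h2.2] at h3
      refine w'.2.1 (isUnit_of_mul_isUnit_right (x := β'.1.1 1 1) ?_)
      rw [← h3.2, mul_one]
      exact (isUnit_of_mem_B0 β.2).2
    · exfalso
      have h1 : β.1 * swapShear w.1 = β'.1 * lowerUnipotent z'.1 := congrArg Subtype.val h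
      have h2 := hM β.1 w.1 β.2
      have h3 := hL β'.1 z'.1 β'.2
      rw [← h1, h2.1, h2.2] at h3
      refine w.2.1 (isUnit_of_mul_isUnit_right (x := β.1.1 1 1) ?_)
      rw [h3.2, mul_one]
      exact (isUnit_of_mem_B0 β'.2).2
    · have h1 : β.1 * swapShear w.1 = β'.1 * swapShear w'.1 := congrArg Subtype.val h
      have h2 := hM β.1 w.1 β.2
      have h3 := hM β'.1 w'.1 β'.2
      rw [← h1, h2.1, h2.2] at h3
      have h4 : β.1.1 1 1 = β'.1.1 1 1 := by simpa using h3.1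
      rw [← h4] at h3
      obtain rfl : w = w' := Subtype.ext ((isUnit_of_mem_B0 β.2).2.mul_left_cancel h3.2)
      obtain rfl : β = β' := Subtype.ext (mul_right_cancel h1)
      rfl
  · rintro ⟨g, hg⟩
    by_cases hy : IsUnit (g.1 1 1)
    · obtain ⟨u, hu⟩ := hy
      set z : ZMod (p ^ n) := ↑u⁻¹ * g.1 1 0 with hz
      have hβ : g * (lowerUnipotent z)⁻¹ ∈ B0 (p ^ n) := by
        change (g.1 * !![1, 0; -z, 1]) 1 0 = 0
        simp [Matrix.mul_apply, Fin.sum_univ_two, ← hu, hz]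
      refine ⟨(Sum.inl ⟨z, ?_⟩, ⟨_, hβ⟩), Subtype.ext (inv_mul_cancel_right g _)⟩
      rw [← hΦ u _ _ u.isUnit]
      simpa [hz, ← mul_assoc, ← hu] using hu ▸ hg
    · obtain ⟨u, hu⟩ := (isUnit_bottomRow hp hn g).resolve_right hy
      set w : ZMod (p ^ n) := ↑u⁻¹ * g.1 1 1 with hw
      have hβ : g * (swapShear w)⁻¹ ∈ B0 (p ^ n) := by
        change (g.1 * !![-w, 1; 1, 0]) 1 0 = 0
        simp [Matrix.mul_apply, Fin.sum_univ_two, ← hu, hw]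
      refine ⟨(Sum.inr ⟨w, fun h => hy ?_, ?_⟩, ⟨_, hβ⟩), Subtype.ext (inv_mul_cancel_right g _)⟩
      · have := u.isUnit.mul h
        simpa [hw] using this
      · rw [← hΦ u _ _ u.isUnit]
        simpa [hw, ← mul_assoc, ← hu] using hu ▸ hg

theorem natCard_bottomRow_roots {ι : Type*} {p n : ℕ} (hp : p.Prime) (hn : 0 < n)
    (b c d : ι → ℤ) :
    Nat.card {g : GL2 (p ^ n) // ∀ i, (c i : ZMod (p ^ n)) * g.1 1 1 ^ 2 +
        d i * (g.1 1 0 * g.1 1 1) - b i * g.1 1 0 ^ 2 = 0} =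
      ((affineRoots p n b c d).card + (infinityRoots p n b c d).card) *
        Nat.card (B0 (p ^ n)) := by
  rw [natCard_of_bottomRow hp hn (fun x y => ∀ i, (c i : ZMod (p ^ n)) * y ^ 2 +
        d i * (x * y) - b i * x ^ 2 = 0)]
  · rw [natCard_zmod_subtype (pow_pos hp.pos n) _ (affineRoots p n b c d),
      natCard_zmod_subtype (pow_pos hp.pos n) _ (infinityRoots p n b c d)]
    · intro w
      rw [mem_infinityRoots, not_isUnit_intCast_iff hp hn, Nat.cast_pow]
      have := fun i => pow_dvd_binaryForm (p := p) (n := n) (b i) (c i) (d i) 1 w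
      simp only [Int.cast_one, one_mul, one_pow, mul_one] at this
      simp only [this, one_mul, one_pow, mul_one]
    · intro z
      rw [mem_affineRoots, Nat.cast_pow]
      have := fun i => pow_dvd_binaryForm (p := p) (n := n) (b i) (c i) (d i) z 1
      simp only [Int.cast_one, one_pow, mul_one] at this
      simp only [this, one_pow, mul_one]
  · intro u x y hu
    refine forall_congr' fun i => ?_
    rw [← (hu.pow 2).mul_right_eq_zero (b := (c i : ZMod (p ^ n)) * y ^ 2 + d i * (x * y) - b i * x ^ 2)]
    ring_nf

theorem natCard_B0_pos {p n : ℕ} (hp : p.Prime) : 0 < Nat.card (B0 (p ^ n)) := by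
  have : NeZero (p ^ n) := ⟨(pow_pos hp.pos n).ne'⟩
  have : Nonempty (B0 (p ^ n)) := ⟨⟨1, by simp [B0]⟩⟩
  exact Nat.card_pos

/-- The number of projective roots does not change when `t` is moved to infinity. -/
theorem card_roots_move_to_infinity {ι : Type*} {p n : ℕ} (hp : p.Prime) (hn : 0 < n)
    (b c d : ι → ℤ) (t : ℤ) :
    (affineRoots p n (fun i => -(c i + d i * t - b i * t ^ 2)) (fun i => - b i)
        (fun i => d i - 2 * b i * t)).card +
      (infinityRoots p n (fun i => -(c i + d i * t - b i * t ^ 2)) (fun i => - b i)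
        (fun i => d i - 2 * b i * t)).card =
    (affineRoots p n b c d).card + (infinityRoots p n b c d).card := by
  refine Nat.eq_of_mul_eq_mul_right (natCard_B0_pos (n := n) hp) ?_
  rw [← natCard_bottomRow_roots hp hn, ← natCard_bottomRow_roots hp hn]
  let h : GL2 (p ^ n) := ⟨!![(t : ZMod (p ^ n)), 1; 1, 0], !![0, 1; 1, -(t : ZMod (p ^ n))],
    by simp [Matrix.one_fin_two], by simp [Matrix.one_fin_two]⟩
  refine Nat.card_congr ((Equiv.mulRight h).subtypeEquiv fun g => forall_congr' fun i => ?_)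
  have h0 : (g * h).1 1 0 = g.1 1 0 * t + g.1 1 1 := by
    simp [h, Matrix.mul_apply, Fin.sum_univ_two]
  have h1 : (g * h).1 1 1 = g.1 1 0 := by
    simp [h, Matrix.mul_apply, Fin.sum_univ_two]
  rw [Equiv.coe_mulRight, h0, h1]
  push_cast
  ring_nf

theorem conj_mem_B0_iff {p n : ℕ} (g r : GL2 (p ^ n)) :
    g * r * g⁻¹ ∈ B0 (p ^ n) ↔
      r.1 1 0 * g.1 1 1 ^ 2 + (r.1 0 0 - r.1 1 1) * (g.1 1 0 * g.1 1 1)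
        - r.1 0 1 * g.1 1 0 ^ 2 = 0 := by
  have hdet := (Matrix.isUnit_iff_isUnit_det g.1).1 g.isUnit
  have hm : (g * r * g⁻¹).1 * g.1 = g.1 * r.1 := by
    rw [← Units.val_mul, inv_mul_cancel_right, Units.val_mul]
  have h0 := congrFun (congrFun hm 1) 0
  have h1 := congrFun (congrFun hm 1) 1
  simp only [Matrix.mul_apply, Fin.sum_univ_two] at h0 h1
  change (g * r * g⁻¹).1 1 0 = 0 ↔ _
  rw [← hdet.mul_left_eq_zero, Matrix.det_fin_two]
  rw [iff_eq_eq]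
  congr 1
  linear_combination g.1 1 1 * h0 - g.1 1 0 * h1

/-- The Borel subgroup as a subgroup. -/
def borelSubgroup (p n : ℕ) : Subgroup (GL2 (p ^ n)) where
  carrier := B0 (p ^ n)
  one_mem' := by simp [B0]
  mul_mem' {a b} ha hb := by
    have ha' : a.1 1 0 = 0 := ha
    have hb' : b.1 1 0 = 0 := hb
    change (a * b).1 1 0 = 0
    simp [Matrix.mul_apply, Fin.sum_univ_two, ha', hb']
  inv_mem' {a} ha := by
    have ha' : a.1 1 0 = 0 := ha
    have h := congrFun (congrFun (a.inv_mul) 1) 0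
    simp only [Matrix.mul_apply, Fin.sum_univ_two, ha', mul_zero, add_zero] at h
    exact (isUnit_of_mem_B0 ha).1.mul_left_eq_zero.1 (by simpa using h)

theorem conjCount_closure_range {ι : Type*} {p n : ℕ} (hp : p.Prime) (hn : 0 < n)
    (G : ι → GL2 (p ^ n)) (A : ι → Matrix (Fin 2) (Fin 2) ℤ)
    (hG : ∀ i, (G i).1 = (A i).map Int.cast) :
    conjCount (B0 (p ^ n)) (Subgroup.closure (Set.range G)) =
      ((affineRoots p n (fun i => A i 0 1) (fun i => A i 1 0)
          (fun i => A i 0 0 - A i 1 1)).card +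
        (infinityRoots p n (fun i => A i 0 1) (fun i => A i 1 0)
          (fun i => A i 0 0 - A i 1 1)).card) * Nat.card (B0 (p ^ n)) := by
  rw [← natCard_bottomRow_roots hp hn, conjCount]
  refine Nat.card_congr (Equiv.subtypeEquivRight fun g => ?_)
  have h1 : (∀ r ∈ Subgroup.closure (Set.range G), g * r * g⁻¹ ∈ B0 (p ^ n)) ↔
      ∀ i, g * G i * g⁻¹ ∈ B0 (p ^ n) := by
    refine ⟨fun h i => h _ (Subgroup.subset_closure ⟨i, rfl⟩), fun h r hr => ?_⟩
    have : Subgroup.closure (Set.range G) ≤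
        (borelSubgroup p n).comap (MulAut.conj g).toMonoidHom := by
      rw [Subgroup.closure_le]
      rintro _ ⟨i, rfl⟩
      exact h i
    exact this hr
  rw [Set.mem_ofPred_eq, h1]
  refine forall_congr' fun i => ?_
  rw [conj_mem_B0_iff, hG]
  simp

theorem redGL_val {p k : ℕ} {g : GL2 (p ^ (k + 1))} {A : Matrix (Fin 2) (Fin 2) ℤ}
    (hg : g.1 = A.map Int.cast) : (redGL p k g).1 = A.map Int.cast := by
  ext i j
  change ZMod.castHom (pow_dvd_pow p (Nat.le_succ k)) (ZMod (p ^ k)) (g.1 i j) = _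
  rw [hg]
  simp

theorem conjCount_map_redGL_closure_range {ι : Type*} {p k : ℕ} (hp : p.Prime) (hk : 0 < k)
    (G : ι → GL2 (p ^ (k + 1))) (A : ι → Matrix (Fin 2) (Fin 2) ℤ)
    (hG : ∀ i, (G i).1 = (A i).map Int.cast) :
    conjCount (B0 (p ^ k)) ((Subgroup.closure (Set.range G)).map (redGL p k)) =
      ((affineRoots p k (fun i => A i 0 1) (fun i => A i 1 0)
          (fun i => A i 0 0 - A i 1 1)).card +
        (infinityRoots p k (fun i => A i 0 1) (fun i => A i 1 0)
          (fun i => A i 0 0 - A i 1 1)).card) * Nat.card (B0 (p ^ k)) := by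
  rw [MonoidHom.map_closure, ← Set.range_comp]
  exact conjCount_closure_range hp hk _ A fun i => redGL_val (hG i)

theorem card_roots_succ {ι : Type*} {p k j : ℕ} (hp : p.Prime) (hodd : Odd p) (hj : j < k)
    {b c d : ι → ℤ}
    (h : (affineRoots p k b c d).card + (infinityRoots p k b c d).card = 2 * p ^ j) :
    (affineRoots p (k + 1) b c d).card + (infinityRoots p (k + 1) b c d).card = 0 ∨
    (affineRoots p (k + 1) b c d).card + (infinityRoots p (k + 1) b c d).card = p ^ j ∨
    (affineRoots p (k + 1) b c d).card + (infinityRoots p (k + 1) b c d).card = 2 * p ^ j := by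
  by_cases hall : ∃ t : ℤ, ∀ z, (p : ℤ) ∣ z - t →
      ¬ ∀ i, (p ^ k : ℤ) ∣ c i + d i * z - b i * z ^ 2
  · obtain ⟨t, ht⟩ := hall
    rw [← card_roots_move_to_infinity hp (by omega) b c d t] at h ⊢
    have hempty : ∀ n, k ≤ n → infinityRoots p n (fun i => -(c i + d i * t - b i * t ^ 2))
        (fun i => - b i) (fun i => d i - 2 * b i * t) = ∅ := by
      intro n hn
      refine Finset.eq_empty_of_forall_notMem fun w hw => ?_
      obtain ⟨-, hpw, hw⟩ := mem_infinityRoots.1 hw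
      refine ht (t + w) (by simpa using hpw) fun i => ?_
      have h3 : (p ^ n : ℤ) ∣ c i + d i * (t + w) - b i * (t + w) ^ 2 := by
        convert hw i using 1
        ring
      exact (pow_dvd_pow (p : ℤ) hn).trans h3
    rw [hempty _ le_rfl, Finset.card_empty, add_zero] at h
    rw [hempty _ k.le_succ, Finset.card_empty, add_zero]
    exact card_affineRoots_succ hp hodd h
  · exfalso
    push Not at hall
    obtain ⟨z₀, h0, hz₀⟩ := hall 0
    obtain ⟨z₁, h1, hz₁⟩ := hall 1
    obtain ⟨z₂, h2, hz₂⟩ := hall 2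
    have hp3 : 3 ≤ p := by
      have := hp.two_le
      obtain ⟨m, hm⟩ := hodd
      omega
    have hone : ¬ (p : ℤ) ∣ 1 := fun hd => by
      have := Int.le_of_dvd one_pos hd
      omega
    have htwo : ¬ (p : ℤ) ∣ 2 := fun hd => by
      have := Int.le_of_dvd two_pos hd
      omega
    have h10 : ¬ (p ^ (0 + 1) : ℤ) ∣ z₁ - z₀ := by
      rw [zero_add, pow_one]
      refine fun hd => hone ?_
      have := dvd_sub (dvd_sub hd h1) (dvd_neg.2 h0)
      ring_nf at this
      simpa using this
    have h20 : ¬ (p ^ (0 + 1) : ℤ) ∣ z₂ - z₀ := by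
      rw [zero_add, pow_one]
      refine fun hd => htwo ?_
      have := dvd_sub (dvd_sub hd h2) (dvd_neg.2 h0)
      ring_nf at this
      simpa using this
    have h21 : ¬ (p ^ (0 + 1) : ℤ) ∣ z₂ - z₁ := by
      rw [zero_add, pow_one]
      refine fun hd => hone ?_
      have := dvd_sub (dvd_sub hd h2) (dvd_neg.2 h1)
      ring_nf at this
      simpa using this
    have slope : ∀ i (z : ℤ), (p ^ k : ℤ) ∣ c i + d i * z - b i * z ^ 2 →
        ¬ (p ^ (0 + 1) : ℤ) ∣ z - z₀ → (p ^ k : ℤ) ∣ d i - b i * (z + z₀) := by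
      intro i z hz hne
      refine pow_dvd_of_pow_add_dvd_mul hp hne ?_
      have h3 : (p ^ k : ℤ) ∣ _ := dvd_sub hz (hz₀ i)
      rw [zero_add]
      convert h3 using 1
      ring
    have hroots : affineRoots p k b c d =
        Finset.filter (fun z => (p ^ 0 : ℤ) ∣ z - 0) (Finset.Ico (0 : ℤ) (p ^ k)) := by
      ext z
      rw [mem_affineRoots, Finset.mem_filter, Finset.mem_Ico]
      refine and_congr_right fun _ => iff_of_true (fun i => ?_) (by simp)
      have hs1 := slope i z₁ (hz₁ i) h10
      have hs2 := slope i z₂ (hz₂ i) h20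
      have hb : (p ^ k : ℤ) ∣ b i := by
        refine pow_dvd_of_pow_add_dvd_mul hp h21 ?_
        have h3 : (p ^ k : ℤ) ∣ _ := dvd_sub hs1 hs2
        rw [zero_add]
        convert h3 using 1
        ring
      have hd : (p ^ k : ℤ) ∣ d i := (dvd_sub_left (hb.mul_right _)).1 hs1
      have h3 : (p ^ k : ℤ) ∣ _ := dvd_sub (dvd_add (hz₀ i) (hd.mul_right (z - z₀)))
        (hb.mul_right (z ^ 2 - z₀ ^ 2))
      convert h3 using 1
      ring
    rw [hroots, card_Ico_filter_pow_dvd_sub hp.pos k.zero_le, Nat.sub_zero] at h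
    have h4 : p ^ (j + 1) ≤ p ^ k := Nat.pow_le_pow_right hp.pos hj
    have h5 : 0 < p ^ j := pow_pos hp.pos j
    rw [pow_succ] at h4
    nlinarith

/-- The generators of the groups realising the possible values. -/
def exampleMatrix (p k j : ℕ) (e₁ e₂ : ℤ) : Fin 3 → Matrix (Fin 2) (Fin 2) ℤ :=
  ![!![1, 0; 0, 1 + p ^ j], !![1, e₁ * p ^ k; 0, 1], !![1, 0; e₂ * p ^ k, 1]]

theorem exists_exampleGenerators {p k j : ℕ} (hp : p.Prime) (hodd : Odd p) (e₁ e₂ : ℤ) :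
    ∃ G : Fin 3 → GL2 (p ^ (k + 1)),
      ∀ i, (G i).1 = (exampleMatrix p k j e₁ e₂ i).map Int.cast := by
  have hu : ∀ i, IsUnit ((exampleMatrix p k j e₁ e₂ i).map
      (Int.cast : ℤ → ZMod (p ^ (k + 1)))) := by
    intro i
    rw [Matrix.isUnit_iff_isUnit_det]
    fin_cases i
    · have : ¬ (p : ℤ) ∣ 1 + p ^ j := by
        have h2 := hp.two_le
        rcases Nat.eq_zero_or_pos j with rfl | hj
        · intro hd
          have := Int.le_of_dvd (by norm_num) hd
          obtain ⟨m, hm⟩ := hodd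
          norm_num at this
          omega
        · intro hd
          have := Int.le_of_dvd one_pos ((dvd_add_left (dvd_pow_self (p : ℤ) hj.ne')).1 hd)
          omega
      have h3 := not_not.1 (mt (not_isUnit_intCast_iff hp k.succ_pos (1 + (p : ℤ) ^ j)).1 this)
      simpa [exampleMatrix, Matrix.det_fin_two] using h3
    · simp [exampleMatrix, Matrix.det_fin_two]
    · simp [exampleMatrix, Matrix.det_fin_two]
  exact ⟨fun i => (hu i).unit, fun i => rfl⟩

theorem pow_dvd_pow_mul_iff {p n j : ℕ} (hp : p.Prime) (hj : j ≤ n) (z : ℤ) :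
    (p ^ n : ℤ) ∣ p ^ j * z ↔ (p ^ (n - j) : ℤ) ∣ z := by
  have h0 : (p : ℤ) ^ j ≠ 0 := pow_ne_zero _ (by exact_mod_cast hp.ne_zero)
  rw [← mul_dvd_mul_iff_left h0 (b := (p : ℤ) ^ (n - j)), ← pow_add,
    Nat.add_sub_cancel' hj]

theorem pow_dvd_mul_pow_mul_sq {p k n : ℕ} {e : ℤ} {z : ℤ} (hn : n ≤ k + 1)
    (hz : (p : ℤ) ∣ z) : (p ^ n : ℤ) ∣ e * p ^ k * z ^ 2 := by
  refine (pow_dvd_pow (p : ℤ) hn).trans ?_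
  rw [pow_succ]
  exact mul_dvd_mul (dvd_mul_left _ _) (hz.trans (dvd_pow_self _ two_ne_zero))

theorem card_example_affineRoots {p k j n : ℕ} (hp : p.Prime) (hj : j < n) (hn : n ≤ k + 1)
    (e₁ e₂ : ℤ) :
    (affineRoots p n (fun i => exampleMatrix p k j e₁ e₂ i 0 1)
      (fun i => exampleMatrix p k j e₁ e₂ i 1 0)
      (fun i => exampleMatrix p k j e₁ e₂ i 0 0 - exampleMatrix p k j e₁ e₂ i 1 1)).card =
      open Classical in if (p ^ n : ℤ) ∣ e₂ * p ^ k then p ^ j else 0 := by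
  split_ifs with h
  · have hcard : p ^ (n - (n - j)) = p ^ j := by rw [Nat.sub_sub_self hj.le]
    rw [← hcard, ← card_Ico_filter_pow_dvd_sub hp.pos (Nat.sub_le n j) 0]
    congr 1
    ext z
    rw [mem_affineRoots, Finset.mem_filter, Finset.mem_Ico, sub_zero]
    refine and_congr_right fun _ => ?_
    have hpz : (p ^ (n - j) : ℤ) ∣ z → (p : ℤ) ∣ z := (dvd_pow_self _ (by omega)).trans
    simp only [Fin.forall_fin_succ, exampleMatrix]
    simpa [h, pow_dvd_pow_mul_iff hp hj.le] using
      fun hz => pow_dvd_mul_pow_mul_sq hn (hpz hz)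
  · rw [Finset.card_eq_zero]
    refine Finset.eq_empty_of_forall_notMem fun z hz => h ?_
    simpa [exampleMatrix] using (mem_affineRoots.1 hz).2 2

theorem card_example_infinityRoots {p k j n : ℕ} (hp : p.Prime) (hj : j < n) (hn : n ≤ k + 1)
    (e₁ e₂ : ℤ) :
    (infinityRoots p n (fun i => exampleMatrix p k j e₁ e₂ i 0 1)
      (fun i => exampleMatrix p k j e₁ e₂ i 1 0)
      (fun i => exampleMatrix p k j e₁ e₂ i 0 0 - exampleMatrix p k j e₁ e₂ i 1 1)).card =
      open Classical in if (p ^ n : ℤ) ∣ e₁ * p ^ k then p ^ j else 0 := by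
  split_ifs with h
  · have hcard : p ^ (n - (n - j)) = p ^ j := by rw [Nat.sub_sub_self hj.le]
    rw [← hcard, ← card_Ico_filter_pow_dvd_sub hp.pos (Nat.sub_le n j) 0]
    congr 1
    ext z
    rw [mem_infinityRoots, Finset.mem_filter, Finset.mem_Ico, sub_zero]
    refine and_congr_right fun _ => ?_
    have hpz : (p ^ (n - j) : ℤ) ∣ z → (p : ℤ) ∣ z := (dvd_pow_self _ (by omega)).trans
    simp only [Fin.forall_fin_succ, exampleMatrix]
    have hiff : ((p : ℤ) ∣ z ∧ (p ^ (n - j) : ℤ) ∣ z ∧ (p ^ n : ℤ) ∣ e₂ * p ^ k * z ^ 2) ↔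
        (p ^ (n - j) : ℤ) ∣ z :=
      ⟨fun hz => hz.2.1, fun hz => ⟨hpz hz, hz, pow_dvd_mul_pow_mul_sq hn (hpz hz)⟩⟩
    simpa [h, pow_dvd_pow_mul_iff hp hj.le] using hiff
  · rw [Finset.card_eq_zero]
    refine Finset.eq_empty_of_forall_notMem fun z hz => h ?_
    simpa [exampleMatrix] using (mem_infinityRoots.1 hz).2.2 1

theorem isogeny_count_lift_from_two_pj
    (p k j : ℕ) (hp : p.Prime) (hodd : Odd p) (hk : 0 < k) (hj : j < k) :
    (∀ R : Subgroup (GL2 (p ^ (k + 1))), ∀ m : ℕ,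
      conjCount (B0 (p ^ k)) (R.map (redGL p k)) =
        (2 * p ^ j) * Nat.card (B0 (p ^ k)) →
      conjCount (B0 (p ^ (k + 1))) R = m * Nat.card (B0 (p ^ (k + 1))) →
      m = 0 ∨ m = p ^ j ∨ m = 2 * p ^ j) ∧
    (∀ m : ℕ, (m = 0 ∨ m = p ^ j ∨ m = 2 * p ^ j) →
      ∃ R : Subgroup (GL2 (p ^ (k + 1))),
        conjCount (B0 (p ^ k)) (R.map (redGL p k)) =
          (2 * p ^ j) * Nat.card (B0 (p ^ k)) ∧
        conjCount (B0 (p ^ (k + 1))) R = m * Nat.card (B0 (p ^ (k + 1)))) := by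
  constructor
  · intro R m h1 h2
    let G : R → GL2 (p ^ (k + 1)) := Subtype.val
    let A : R → Matrix (Fin 2) (Fin 2) ℤ := fun r => (r.1.1).map ZMod.cast
    have hG : ∀ i, (G i).1 = (A i).map Int.cast := by
      intro r
      ext i j
      simp [G, A]
    have hR : Subgroup.closure (Set.range G) = R := by
      simp [G]
    rw [← hR, conjCount_map_redGL_closure_range hp hk G A hG] at h1
    rw [← hR, conjCount_closure_range hp k.succ_pos G A hG] at h2
    have h1' := Nat.eq_of_mul_eq_mul_right (natCard_B0_pos hp) h1
    have h2' := Nat.eq_of_mul_eq_mul_right (natCard_B0_pos hp) h2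
    rw [← h2']
    exact card_roots_succ hp hodd hj h1'
  · have main : ∀ e₁ e₂ : ℤ, ∃ R : Subgroup (GL2 (p ^ (k + 1))),
        conjCount (B0 (p ^ k)) (R.map (redGL p k)) =
          (2 * p ^ j) * Nat.card (B0 (p ^ k)) ∧
        conjCount (B0 (p ^ (k + 1))) R = ((open Classical in
          if (p ^ (k + 1) : ℤ) ∣ e₂ * p ^ k then p ^ j else 0) + (open Classical in
          if (p ^ (k + 1) : ℤ) ∣ e₁ * p ^ k then p ^ j else 0)) *
            Nat.card (B0 (p ^ (k + 1))) := by
      intro e₁ e₂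
      obtain ⟨G, hG⟩ := exists_exampleGenerators (k := k) (j := j) hp hodd e₁ e₂
      refine ⟨Subgroup.closure (Set.range G), ?_, ?_⟩
      · rw [conjCount_map_redGL_closure_range hp hk G _ hG,
          card_example_affineRoots hp hj k.le_succ, card_example_infinityRoots hp hj k.le_succ,
          if_pos (dvd_mul_left _ _), if_pos (dvd_mul_left _ _), two_mul]
      · rw [conjCount_closure_range hp k.succ_pos G _ hG,
          card_example_affineRoots hp (by omega) le_rfl,
          card_example_infinityRoots hp (by omega) le_rfl]
    have hnot : ¬ (p ^ (k + 1) : ℤ) ∣ 1 * p ^ k := by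
      rw [one_mul, pow_dvd_pow_iff (by exact_mod_cast hp.ne_zero)
        (Nat.prime_iff_prime_int.1 hp).not_isUnit]
      omega
    have hzero : (p ^ (k + 1) : ℤ) ∣ 0 * p ^ k := by simp
    rintro m (rfl | rfl | rfl)
    · simpa only [if_neg hnot] using main 1 1
    · simpa only [if_neg hnot, if_pos hzero, add_zero] using main 1 0
    · simpa only [if_pos hzero, ← two_mul] using main 0 0
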